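/- Let H be a real Hilbert space and T : H → H a bounded linear operator that is self-adjoint, positive semidefinite, and non-expansive (‖T‖ ≤ 1). Then T is asymptotically regular: for every x ∈ H, ‖T^{k+1} x − T^k x‖ → 0 as k → ∞. -/

import Mathlib

open Filter
open scoped RealInnerProductSpace

/-- Asymptotic regularity (Theorem 2.3 (i) in abstract form): for a self-adjoint,
positive semidefinite, non-expansive bounded operator on a real Hilbert space,
`‖T^{k+1} x - T^k x‖ → 0` for every `x`. -/
theorem stmt_3
    {H : Type*} [NormedAddCommGroup H] [InnerProductSpace ℝ H] [CompleteSpace H]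
    (T : H →L[ℝ] H)
    (hsa : ∀ x y : H, ⟪T x, y⟫ = ⟪x, T y⟫)
    (hpos : ∀ x : H, 0 ≤ ⟪T x, x⟫)
    (hne : ‖T‖ ≤ 1) :
    ∀ x : H, Tendsto (fun k : ℕ => ‖(T ^ (k + 1)) x - (T ^ k) x‖) atTop (nhds 0) := by
  intro x
  have hle : ∀ y : H, ‖T y‖ ≤ ‖y‖ := fun y => by
    simpa using T.le_of_opNorm_le hne y
  have key : ∀ y : H, ‖T y - y‖ ^ 2 ≤ ‖y‖ ^ 2 - ‖T y‖ ^ 2 := fun y => by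
    have h1 := hpos (y - T y)
    rw [map_sub, inner_sub_left, inner_sub_right, inner_sub_right, hsa (T y) y,
      real_inner_self_eq_norm_sq] at h1
    have h2 : ⟪T (T y), T y⟫ ≤ ‖T y‖ ^ 2 := by
      refine (real_inner_le_norm _ _).trans ?_
      nlinarith [hle (T y), norm_nonneg (T y)]
    rw [norm_sub_sq_real]
    have h3 := hsa y y
    nlinarith
  have hs : ∀ k : ℕ, (T ^ (k + 1)) x = T ((T ^ k) x) := fun k => by
    rw [pow_succ']; rfl
  have hanti : Antitone (fun k : ℕ => ‖(T ^ k) x‖ ^ 2) := by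
    refine antitone_nat_of_succ_le fun k => ?_
    rw [hs k]
    exact pow_le_pow_left₀ (norm_nonneg _) (hle _) 2
  have hbdd : BddBelow (Set.range (fun k : ℕ => ‖(T ^ k) x‖ ^ 2)) :=
    ⟨0, by rintro _ ⟨k, rfl⟩; positivity⟩
  have hl := tendsto_atTop_ciInf hanti hbdd
  have hd := hl.sub (hl.comp (tendsto_add_atTop_nat 1))
  rw [sub_self] at hd
  have hsq : Tendsto (fun k : ℕ => ‖(T ^ (k + 1)) x - (T ^ k) x‖ ^ 2) atTop (nhds 0) := by
    refine squeeze_zero (fun k => by positivity) (fun k => ?_) hd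
    have := key ((T ^ k) x)
    rw [← hs k] at this
    exact this
  have := hsq.sqrt
  simpa [Real.sqrt_sq] using this
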